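/- arXiv:1901.11154 — 8 statements merged into one kernel-verified Lean document; each statement's English description precedes it below -/
import Mathlib

section
/- For all integers m >= 3, r >= 3, s >= 1 such that choose(r+m, m) >= m*r*(s+1) - (r+1)*s + 1, the real number F(m,r,s) satisfies F(m,r,s) >= 6 + 12/((r+1)*s + 1). -/
/-- The integer polynomial `P(m,r,s)` (numerator data of the slope function). -/
def P (m r s : ℤ) : ℤ :=
  m^2*r^5*s^4 - m^2*r^5*s^2 + 3*m^2*r^4*s^4 + 5*m^2*r^4*s^3 + m^2*r^4*s^2 - m^2*r^4*s
  + m^2*r^3*s^4 + 12*m^2*r^3*s^3 + 13*m^2*r^3*s^2 - 2*m^2*r^3*s - 4*m^2*r^3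
  - 3*m^2*r^2*s^4 - 5*m^2*r^2*s^3 + m^2*r^2*s^2 + 3*m^2*r^2*s
  - 2*m^2*r*s^4 - 12*m^2*r*s^3 - 14*m^2*r*s^2 + 4*m^2*r
  - m*r^5*s^4 + m*r^5*s^2 - 5*m*r^4*s^4 - 5*m*r^4*s^3 - m*r^4*s^2 + m*r^4*s
  - 9*m*r^3*s^4 - 26*m*r^3*s^3 - 13*m*r^3*s^2 + 22*m*r^3*s + 4*m*r^3
  - 7*m*r^2*s^4 - 37*m*r^2*s^3 - 5*m*r^2*s^2 + 57*m*r^2*s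
  - 2*m*r*s^4 - 16*m*r*s^3 + 6*m*r*s^2 + 40*m*r*s - 4*m*r
  + 2*r^4*s^2 + 2*r^3*s^3 + 8*r^3*s^2 - 6*r^3*s
  + 6*r^2*s^3 + 6*r^2*s^2 - 18*r^2*s + 4*r^2
  + 6*r*s^3 - 4*r*s^2 - 14*r*s + 8*r + 2*s^3 - 4*s^2 - 2*s + 4

/-- The integer polynomial `Q(m,r,s)` (denominator data of the slope function). -/
def Q (m r s : ℤ) : ℤ :=
  m*r^3*s^3 - m*r^3*s^2 + 2*m*r^2*s^3 + m*r^2*s^2 - m*r*s^3 + 5*m*r*s^2 + m*r*s - 2*m*r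
  - 2*m*s^3 - 5*m*s^2 - m*s + 2*m - r^3*s^3 + r^3*s^2 - 4*r^2*s^3 + r^2*s^2 - 5*r*s^3
  - 7*r*s^2 + 7*r*s + 2*r - 2*s^3 - 7*s^2 + 17*s - 2

/-- The slope function `F(m,r,s) = 6 P(m,r,s) / (m r (r+1) (s+1) Q(m,r,s))`, as a real number. -/
noncomputable def F (m r s : ℤ) : ℝ :=
  6 * (P m r s : ℝ) / ((m * r * (r + 1) * (s + 1) * Q m r s : ℤ) : ℝ)

/-- The denominator factor `Q` is positive throughout the range of interest. -/
theorem Q_pos {m r s : ℤ} (hm : 3 ≤ m) (hr : 3 ≤ r) (hs : 1 ≤ s) : 0 < Q m r s := by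
  obtain ⟨a, rfl⟩ := Int.le.dest hm
  obtain ⟨b, rfl⟩ := Int.le.dest hr
  obtain ⟨c, rfl⟩ := Int.le.dest hs
  unfold Q
  ring_nf
  positivity

/-- The numerator of `F m r s - (6 + 12 / (g + 1))`, up to a factor `6`, where `g = (r + 1) * s`. -/
def slopeGap (m r s : ℤ) : ℤ :=
  P m r s * ((r + 1) * s + 1) - m * r * (r + 1) * (s + 1) * Q m r s * ((r + 1) * s + 3)

theorem slopeGap_nonneg_of_five_le {m r s : ℤ} (hm : 5 ≤ m) (hr : 3 ≤ r) (hs : 1 ≤ s) :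
    0 ≤ slopeGap m r s := by
  obtain ⟨a, rfl⟩ := Int.le.dest hm
  obtain ⟨b, rfl⟩ := Int.le.dest hr
  obtain ⟨c, rfl⟩ := Int.le.dest hs
  unfold slopeGap P Q
  ring_nf
  positivity

theorem slopeGap_four_nonneg {r s : ℤ} (hr : 4 ≤ r) (hs : 1 ≤ s) : 0 ≤ slopeGap 4 r s := by
  obtain ⟨b, rfl⟩ := Int.le.dest hr
  obtain ⟨c, rfl⟩ := Int.le.dest hs
  unfold slopeGap P Q
  ring_nf
  positivity

theorem slopeGap_three_nonneg {r s : ℤ} (hr : 7 ≤ r) (hs : 1 ≤ s) : 0 ≤ slopeGap 3 r s := by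
  obtain ⟨b, rfl⟩ := Int.le.dest hr
  obtain ⟨c, rfl⟩ := Int.le.dest hs
  unfold slopeGap P Q
  ring_nf
  positivity

/-- The binomial condition is needed only for `m = 3`, `r ≤ 6` and for `m = 4`, `r = 3`, where it
leaves finitely many values of `s`. -/
theorem slopeGap_nonneg {m r s : ℤ} (hm : 3 ≤ m) (hr : 3 ≤ r) (hs : 1 ≤ s)
    (hch : m * r * (s + 1) - (r + 1) * s + 1 ≤ ((r + m).toNat.choose m.toNat : ℤ)) :
    0 ≤ slopeGap m r s := by
  obtain hm5 | hm5 := le_or_gt 5 m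
  · exact slopeGap_nonneg_of_five_le hm5 hr hs
  obtain rfl | rfl : m = 3 ∨ m = 4 := by omega
  · obtain hr7 | hr7 := le_or_gt 7 r
    · exact slopeGap_three_nonneg hr7 hs
    have hs' : s ≤ 7 := by
      interval_cases r <;> simp [Nat.choose] at hch <;> omega
    interval_cases r <;> interval_cases s <;> revert hch <;> decide
  · obtain hr4 | hr4 := le_or_gt 4 r
    · exact slopeGap_four_nonneg hr4 hs
    obtain rfl : r = 3 := by omega
    have hs' : s ≤ 2 := by
      simp [Nat.choose] at hch
      omega
    interval_cases s <;> decide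

theorem stmt0 (m r s : ℤ) (hm : 3 ≤ m) (hr : 3 ≤ r) (hs : 1 ≤ s)
    (hch : m * r * (s + 1) - (r + 1) * s + 1 ≤ ((r + m).toNat.choose m.toNat : ℤ)) :
    F m r s ≥ 6 + 12 / (((r : ℝ) + 1) * (s : ℝ) + 1) := by
  have hQ : (0 : ℝ) < Q m r s := by exact_mod_cast Q_pos hm hr hs
  have hgap : (0 : ℝ) ≤ slopeGap m r s := by exact_mod_cast slopeGap_nonneg hm hr hs hch
  have hm' : (3 : ℝ) ≤ m := by exact_mod_cast hm
  have hr' : (3 : ℝ) ≤ r := by exact_mod_cast hr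
  have hs' : (1 : ℝ) ≤ s := by exact_mod_cast hs
  have hg : (0 : ℝ) < (r + 1) * s + 1 := by positivity
  have hden : (0 : ℝ) < m * r * (r + 1) * (s + 1) * Q m r s := by positivity
  have hsum : (6 : ℝ) + 12 / ((r + 1) * s + 1) = 6 * ((r + 1) * s + 3) / ((r + 1) * s + 1) := by
    field_simp
    ring
  unfold slopeGap at hgap
  push_cast at hgap
  unfold F
  push_cast
  rw [ge_iff_le, hsum, div_le_div_iff₀ hg hden]
  linarith
end

section
/- For all integers m >= 3, r >= 3, s >= 1 such that choose(r+m, m) >= m*r*(s+1) - (r+1)*s + 1, the equality F(m,r,s) = 6 + 12/((r+1)*s + 1) holds if and only if m = 3, r = 3 and s = 2. -/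
/-- The cleared-denominator form of `F(m,r,s) - (6 + 12 / (g + 1))`, up to a positive factor and the
sign of `Q`, where `g = (r + 1) s`. -/
def slopeExcess (m r s : ℤ) : ℤ :=
  P m r s * ((r + 1) * s + 1) - m * r * (r + 1) * (s + 1) * Q m r s * ((r + 1) * s + 3)

theorem slopeExcess_eq_zero_of_F_eq {m r s : ℤ} (hr : 3 ≤ r) (hs : 1 ≤ s)
    (h : F m r s = 6 + 12 / (((r : ℝ) + 1) * (s : ℝ) + 1)) : slopeExcess m r s = 0 := by
  have hg : (0 : ℝ) < ((r : ℝ) + 1) * (s : ℝ) + 1 := by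
    have hr' : (3 : ℝ) ≤ r := by exact_mod_cast hr
    have hs' : (1 : ℝ) ≤ s := by exact_mod_cast hs
    positivity
  have hF : F m r s ≠ 0 := by
    rw [h]
    positivity
  have hD : ((m * r * (r + 1) * (s + 1) * Q m r s : ℤ) : ℝ) ≠ 0 := by
    intro h0
    exact hF (by rw [F, h0, div_zero])
  rw [F, div_eq_iff hD] at h
  field_simp at h
  have hz : (slopeExcess m r s : ℝ) = 0 := by
    simp only [slopeExcess]
    push_cast at h ⊢
    linarith
  exact_mod_cast hz

/-- Outside a few pairs `(m, r)` the slope never attains the bound, whatever `s` is. -/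
theorem slopeExcess_pos_of_five_le {m r s : ℤ} (hm : 5 ≤ m) (hr : 3 ≤ r) (hs : 1 ≤ s) :
    0 < slopeExcess m r s := by
  obtain ⟨a, rfl⟩ := Int.le.dest hm
  obtain ⟨b, rfl⟩ := Int.le.dest hr
  obtain ⟨c, rfl⟩ := Int.le.dest hs
  simp only [slopeExcess, P, Q]
  ring_nf
  positivity

theorem slopeExcess_four_pos {r s : ℤ} (hr : 4 ≤ r) (hs : 1 ≤ s) : 0 < slopeExcess 4 r s := by
  obtain ⟨b, rfl⟩ := Int.le.dest hr
  obtain ⟨c, rfl⟩ := Int.le.dest hs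
  simp only [slopeExcess, P, Q]
  ring_nf
  positivity

theorem slopeExcess_three_pos {r s : ℤ} (hr : 7 ≤ r) (hs : 1 ≤ s) : 0 < slopeExcess 3 r s := by
  obtain ⟨b, rfl⟩ := Int.le.dest hr
  obtain ⟨c, rfl⟩ := Int.le.dest hs
  simp only [slopeExcess, P, Q]
  ring_nf
  positivity

theorem eq_of_slopeExcess_eq_zero {m r s : ℤ} (hm : 3 ≤ m) (hr : 3 ≤ r) (hs : 1 ≤ s)
    (hch : m * r * (s + 1) - (r + 1) * s + 1 ≤ ((r + m).toNat.choose m.toNat : ℤ))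
    (h : slopeExcess m r s = 0) : m = 3 ∧ r = 3 ∧ s = 2 := by
  have hm5 : m < 5 := by
    by_contra! hm5
    exact (slopeExcess_pos_of_five_le hm5 hr hs).ne' h
  obtain rfl | rfl : m = 3 ∨ m = 4 := by omega
  · have hr7 : r < 7 := by
      by_contra! hr7
      exact (slopeExcess_three_pos hr7 hs).ne' h
    interval_cases r <;> simp [Nat.choose] at hch <;>
    · have hs5 : s ≤ 5 := by linarith
      interval_cases s <;> first | omega | norm_num [slopeExcess, P, Q] at h
  · have hr4 : r < 4 := by
      by_contra! hr4
      exact (slopeExcess_four_pos hr4 hs).ne' h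
    obtain rfl : r = 3 := by omega
    simp [Nat.choose] at hch
    have hs2 : s ≤ 2 := by linarith
    interval_cases s <;> norm_num [slopeExcess, P, Q] at h

theorem stmt1 (m r s : ℤ) (hm : 3 ≤ m) (hr : 3 ≤ r) (hs : 1 ≤ s)
    (hch : m * r * (s + 1) - (r + 1) * s + 1 ≤ ((r + m).toNat.choose m.toNat : ℤ)) :
    F m r s = 6 + 12 / (((r : ℝ) + 1) * (s : ℝ) + 1) ↔ m = 3 ∧ r = 3 ∧ s = 2 := by
  constructor
  · intro h
    exact eq_of_slopeExcess_eq_zero hm hr hs hch (slopeExcess_eq_zero_of_F_eq hr hs h)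
  · rintro ⟨rfl, rfl, rfl⟩
    norm_num [F, P, Q]
end

section
/- For all integers r >= 3 and s >= 1 with 2*s <= r, the real number F(2,r,s) satisfies F(2,r,s) > 6 + 8/((r+1)*s + 1). -/
/-- Substitution principle for the region `3 ≤ r`, `1 ≤ s`, `2 * s ≤ r`: it is the union of the
ray `s = 1`, `r = 3 + b` and the cone `s = 2 + a`, `r = 4 + 2 * a + b` with `a, b ≥ 0`. -/
theorem ray_or_cone {r s : ℤ} (hr : 3 ≤ r) (hs : 1 ≤ s) (hrs : 2 * s ≤ r) :
    (∃ b : ℤ, 0 ≤ b ∧ s = 1 ∧ r = 3 + b) ∨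
      ∃ a b : ℤ, 0 ≤ a ∧ 0 ≤ b ∧ s = 2 + a ∧ r = 4 + 2 * a + b := by
  rcases hs.eq_or_lt with h | h
  · exact Or.inl ⟨r - 3, by lia, by lia, by lia⟩
  · exact Or.inr ⟨s - 2, r - 2 * s, by lia, by lia, by lia, by lia⟩

/-- The denominator polynomial is positive for `m = 2` when `2 * s ≤ r`. -/
theorem Q_two_pos {r s : ℤ} (hr : 3 ≤ r) (hs : 1 ≤ s) (hrs : 2 * s ≤ r) : 0 < Q 2 r s := by
  rcases ray_or_cone hr hs hrs with ⟨b, hb, rfl, rfl⟩ | ⟨a, b, ha, hb, rfl, rfl⟩ <;>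
  · unfold Q
    ring_nf
    positivity

/-- The slope bound for `m = 2` with denominators cleared, where `g = (r + 1) * s`. -/
theorem slope_bound_cleared {r s : ℤ} (hr : 3 ≤ r) (hs : 1 ≤ s) (hrs : 2 * s ≤ r) :
    (6 * ((r + 1) * s + 1) + 8) * (2 * r * (r + 1) * (s + 1) * Q 2 r s) <
      6 * P 2 r s * ((r + 1) * s + 1) := by
  rw [← sub_pos]
  rcases ray_or_cone hr hs hrs with ⟨b, hb, rfl, rfl⟩ | ⟨a, b, ha, hb, rfl, rfl⟩ <;>
  · unfold P Q
    ring_nf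
    positivity

theorem stmt2 (r s : ℤ) (hr : 3 ≤ r) (hs : 1 ≤ s) (hrs : 2 * s ≤ r) :
    F 2 r s > 6 + 8 / (((r : ℝ) + 1) * (s : ℝ) + 1) := by
  have hQ := Q_two_pos hr hs hrs
  have hden : 0 < 2 * r * (r + 1) * (s + 1) * Q 2 r s := by
    have : 0 < r := by lia
    positivity
  have hg : 0 < (r + 1) * s + 1 := by
    have : 0 < r := by lia
    positivity
  have hden' : (0 : ℝ) < ((2 * r * (r + 1) * (s + 1) * Q 2 r s : ℤ) : ℝ) := by exact_mod_cast hden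
  have hg' : (0 : ℝ) < ((r : ℝ) + 1) * s + 1 := by exact_mod_cast hg
  have hbound : (6 * (((r : ℝ) + 1) * s + 1) + 8) *
      ((2 * r * (r + 1) * (s + 1) * Q 2 r s : ℤ) : ℝ) <
        6 * (P 2 r s : ℝ) * (((r : ℝ) + 1) * s + 1) := by
    exact_mod_cast slope_bound_cleared hr hs hrs
  rw [F, gt_iff_lt, add_div' _ _ _ hg'.ne', div_lt_div_iff₀ hg' hden']
  exact hbound
end

section
/- For all integers m >= 2, r >= 3, s >= 1, setting e = m*r*(s+1) - (r+1)*s + 1: if choose(r+m, m) >= e + 2, then choose(r+m, m) * e >= (r+1)^2 + e^2. -/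
theorem succ_mul_add_two_le_two_mul_choose (m r : ℕ) (hm : 2 ≤ m) :
    (r + 1) * (r + 2) ≤ 2 * (r + m).choose m := by
  have hmono : (r + 2).choose r ≤ (r + m).choose r := Nat.choose_le_choose r (by lia)
  rw [Nat.choose_symm_add, Nat.choose_symm_add] at hmono
  have htri : (r + 2).choose 2 * 2 = (r + 2) * (r + 1) := by
    simpa using (Nat.add_one_mul_choose_eq (r + 1) 1).symm
  linarith

theorem stmt9 (m r s : ℤ) (hm : 2 ≤ m) (hr : 3 ≤ r) (hs : 1 ≤ s)
    (e : ℤ) (he : e = m * r * (s + 1) - (r + 1) * s + 1)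
    (hch : e + 2 ≤ ((r + m).toNat.choose m.toNat : ℤ)) :
    (r + 1) ^ 2 + e ^ 2 ≤ ((r + m).toNat.choose m.toNat : ℤ) * e := by
  have hN : (r + 1) * (r + 2) ≤ 2 * ((r + m).toNat.choose m.toNat : ℤ) := by
    lift m to ℕ using by lia
    lift r to ℕ using by lia
    exact_mod_cast succ_mul_add_two_le_two_mul_choose m r (by lia)
  generalize ((r + m).toNat.choose m.toNat : ℤ) = N at hch hN ⊢
  have he_ge : 3 * r ≤ e := by
    have h₁ : 0 ≤ (m - 2) * r * (s + 1) := by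
      have : 0 ≤ m - 2 := by lia
      positivity
    have h₂ : 0 ≤ (r - 1) * (s - 1) := mul_nonneg (by lia) (by lia)
    linarith
  rcases le_or_gt ((r + 1) ^ 2) (2 * e) with h | h
  · nlinarith
  · have hgap : r + 2 ≤ 2 * (N - e) := by linarith
    have hprod : 3 * r * (r + 2) ≤ e * (2 * (N - e)) :=
      mul_le_mul he_ge hgap (by lia) (by lia)
    nlinarith
end

section
/- For all integers r >= 3 and s >= 1 with 2*s <= r, the denominator r*(1+r)*(1+s)*(1+s+r*s)*(2 - 2*r + 15*s + 9*r*s - 17*s^2 + 3*r*s^2 + 3*r^2*s^2 - r^3*s^2 - 6*s^3 - 7*r*s^3 + r^3*s^3) is nonzero, and F(2,r,s) - (6 + 12/((r+1)*s + 1)) = (6*(1 + r + s)*(1 + r^2 + s - 3*r*s)*(-2 + s + r*s)*(-1 + s + r*s)) / (r*(1+r)*(1+s)*(1+s+r*s)*(2 - 2*r + 15*s + 9*r*s - 17*s^2 + 3*r*s^2 + 3*r^2*s^2 - r^3*s^2 - 6*s^3 - 7*r*s^3 + r^3*s^3)). -/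
/-- The cubic factor of the denominator is positive on the range of parameters. -/
theorem denominator_factor_pos {r s : ℤ} (hr : 3 ≤ r) (hs : 1 ≤ s) (hrs : 2 * s ≤ r) :
    0 < 2 - 2 * r + 15 * s + 9 * r * s - 17 * s ^ 2 + 3 * r * s ^ 2 + 3 * r ^ 2 * s ^ 2
      - r ^ 3 * s ^ 2 - 6 * s ^ 3 - 7 * r * s ^ 3 + r ^ 3 * s ^ 3 := by
  obtain rfl | hs2 := hs.eq_or_lt
  · nlinarith
  · obtain ⟨u, rfl⟩ : ∃ u, s = 2 + u := ⟨s - 2, by ring⟩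
    obtain ⟨t, rfl⟩ : ∃ t, r = 2 * (2 + u) + t := ⟨r - 2 * (2 + u), by ring⟩
    have hu : 0 ≤ u := by lia
    have ht : 0 ≤ t := by lia
    ring_nf
    positivity

theorem stmt10 (r s : ℤ) (hr : 3 ≤ r) (hs : 1 ≤ s) (hrs : 2 * s ≤ r) :
    ((r : ℝ) * (1 + r) * (1 + s) * (1 + s + r * s) *
        (2 - 2 * r + 15 * s + 9 * r * s - 17 * s ^ 2 + 3 * r * s ^ 2 + 3 * r ^ 2 * s ^ 2
          - r ^ 3 * s ^ 2 - 6 * s ^ 3 - 7 * r * s ^ 3 + r ^ 3 * s ^ 3) ≠ 0) ∧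
    F 2 r s - (6 + 12 / (((r : ℝ) + 1) * (s : ℝ) + 1)) =
      (6 * (1 + (r : ℝ) + s) * (1 + r ^ 2 + s - 3 * r * s) * (-2 + s + r * s) * (-1 + s + r * s)) /
        ((r : ℝ) * (1 + r) * (1 + s) * (1 + s + r * s) *
          (2 - 2 * r + 15 * s + 9 * r * s - 17 * s ^ 2 + 3 * r * s ^ 2 + 3 * r ^ 2 * s ^ 2
            - r ^ 3 * s ^ 2 - 6 * s ^ 3 - 7 * r * s ^ 3 + r ^ 3 * s ^ 3)) := by
  have hD : (0 : ℝ) < 2 - 2 * r + 15 * s + 9 * r * s - 17 * s ^ 2 + 3 * r * s ^ 2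
      + 3 * r ^ 2 * s ^ 2 - r ^ 3 * s ^ 2 - 6 * s ^ 3 - 7 * r * s ^ 3 + r ^ 3 * s ^ 3 := by
    exact_mod_cast denominator_factor_pos hr hs hrs
  have hQ : (Q 2 r s : ℝ) = 2 - 2 * r + 15 * s + 9 * r * s - 17 * s ^ 2 + 3 * r * s ^ 2
      + 3 * r ^ 2 * s ^ 2 - r ^ 3 * s ^ 2 - 6 * s ^ 3 - 7 * r * s ^ 3 + r ^ 3 * s ^ 3 := by
    simp only [Q]
    push_cast
    ring
  have hr0 : (0 : ℝ) < r := by exact_mod_cast (by lia : 0 < r)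
  have hs0 : (0 : ℝ) < s := by exact_mod_cast (by lia : 0 < s)
  refine ⟨by positivity, ?_⟩
  simp only [F, P]
  push_cast
  rw [hQ]
  generalize hd : (2 - 2 * r + 15 * s + 9 * r * s - 17 * s ^ 2 + 3 * r * s ^ 2
      + 3 * r ^ 2 * s ^ 2 - r ^ 3 * s ^ 2 - 6 * s ^ 3 - 7 * r * s ^ 3 + r ^ 3 * s ^ 3 : ℝ) = d
    at hD ⊢
  have hg : ((r : ℝ) + 1) * s + 1 = 1 + s + r * s := by ring
  have hg0 : (1 + s + r * s : ℝ) ≠ 0 := by positivity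
  have hr1 : (r + 1 : ℝ) ≠ 0 := by positivity
  have hs1 : (s + 1 : ℝ) ≠ 0 := by positivity
  rw [hg, add_comm 1 (r : ℝ), add_comm 1 (s : ℝ)]
  rw [add_comm 1 (s : ℝ)] at hg0
  field_simp
  rw [← hd]
  ring
end

section
/- For all integers m >= 0 and s >= 0, F(m+5, 3, s+1) - (6 + 12/(4*(s+1) + 1)) = ((5+s)*(1+2*s)*(3+4*s)*(65+39*m+6*m^2+s+12*m*s+3*m^2*s)) / ((5+m)*(2+s)*(5+4*s)*(60+15*m+172*s+53*m*s+164*s^2+56*m*s^2+60*s^3+20*m*s^3)), and in particular this difference is positive. -/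
/-- `Q` at `r = 3`, recentred at `m = 5`, `s = 1`, has nonnegative coefficients. -/
lemma Q_add_five_three_add_one (m s : ℤ) :
    Q (m + 5) 3 (s + 1) = 2 * (60 + 15 * m + 172 * s + 53 * m * s + 164 * s ^ 2 + 56 * m * s ^ 2
      + 60 * s ^ 3 + 20 * m * s ^ 3) := by
  unfold Q
  ring

theorem stmt13 (m s : ℤ) (hm : 0 ≤ m) (hs : 0 ≤ s) :
    F (m + 5) 3 (s + 1) - (6 + 12 / (4 * ((s : ℝ) + 1) + 1)) =
      ((5 + (s : ℝ)) * (1 + 2 * s) * (3 + 4 * s) *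
          (65 + 39 * m + 6 * m ^ 2 + s + 12 * m * s + 3 * m ^ 2 * s)) /
        ((5 + (m : ℝ)) * (2 + s) * (5 + 4 * s) *
          (60 + 15 * m + 172 * s + 53 * m * s + 164 * s ^ 2 + 56 * m * s ^ 2
            + 60 * s ^ 3 + 20 * m * s ^ 3)) ∧
    0 < F (m + 5) 3 (s + 1) - (6 + 12 / (4 * ((s : ℝ) + 1) + 1)) := by
  have hm' : (0 : ℝ) ≤ m := by exact_mod_cast hm
  have hs' : (0 : ℝ) ≤ s := by exact_mod_cast hs
  have key : F (m + 5) 3 (s + 1) - (6 + 12 / (4 * ((s : ℝ) + 1) + 1)) =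
      ((5 + (s : ℝ)) * (1 + 2 * s) * (3 + 4 * s) *
          (65 + 39 * m + 6 * m ^ 2 + s + 12 * m * s + 3 * m ^ 2 * s)) /
        ((5 + (m : ℝ)) * (2 + s) * (5 + 4 * s) *
          (60 + 15 * m + 172 * s + 53 * m * s + 164 * s ^ 2 + 56 * m * s ^ 2
            + 60 * s ^ 3 + 20 * m * s ^ 3)) := by
    rw [F, Q_add_five_three_add_one, P]
    push_cast
    generalize (m : ℝ) = x at *
    generalize (s : ℝ) = y at *
    have hz : 4 * (y + 1) + 1 ≠ 0 := by positivity
    rw [add_comm (6 : ℝ), div_add' _ _ _ hz, div_sub_div _ _ (by positivity) hz,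
      div_eq_div_iff (by positivity) (by positivity)]
    ring
  refine ⟨key, ?_⟩
  rw [key]
  positivity
end

section
/- For all integers r >= 0 and s >= 0, F(2, r+4, s+1) - (6 + 12/((r+5)*(s+1) + 1)) = (6*(6+r+s)*(6+5*r+r^2-11*s-3*r*s)*(3+r+5*s+r*s)*(4+r+5*s+r*s)) / ((4+r)*(5+r)*(2+s)*(6+r+5*s+r*s)*(54+27*r+3*r^2+99*s+90*r*s+18*r^2*s+r^3*s+69*s^2+102*r*s^2+27*r^2*s^2+2*r^3*s^2+30*s^3+41*r*s^3+12*r^2*s^3+r^3*s^3)), and the denominator on the right-hand side is positive. -/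
/-- The shifted denominator `Q(2, r+4, s+1)` has only nonnegative coefficients. -/
theorem Q_two_add_four_add_one (r s : ℤ) : Q 2 (r + 4) (s + 1) =
    54 + 27 * r + 3 * r ^ 2 + 99 * s + 90 * r * s + 18 * r ^ 2 * s + r ^ 3 * s
      + 69 * s ^ 2 + 102 * r * s ^ 2 + 27 * r ^ 2 * s ^ 2 + 2 * r ^ 3 * s ^ 2
      + 30 * s ^ 3 + 41 * r * s ^ 3 + 12 * r ^ 2 * s ^ 3 + r ^ 3 * s ^ 3 := by
  unfold Q
  ring

theorem stmt17 (r s : ℤ) (hr : 0 ≤ r) (hs : 0 ≤ s) :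
    F 2 (r + 4) (s + 1) - (6 + 12 / (((r : ℝ) + 5) * ((s : ℝ) + 1) + 1)) =
      (6 * (6 + (r : ℝ) + s) * (6 + 5 * r + r ^ 2 - 11 * s - 3 * r * s) *
          (3 + r + 5 * s + r * s) * (4 + r + 5 * s + r * s)) /
        ((4 + (r : ℝ)) * (5 + r) * (2 + s) * (6 + r + 5 * s + r * s) *
          (54 + 27 * r + 3 * r ^ 2 + 99 * s + 90 * r * s + 18 * r ^ 2 * s + r ^ 3 * s
            + 69 * s ^ 2 + 102 * r * s ^ 2 + 27 * r ^ 2 * s ^ 2 + 2 * r ^ 3 * s ^ 2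
            + 30 * s ^ 3 + 41 * r * s ^ 3 + 12 * r ^ 2 * s ^ 3 + r ^ 3 * s ^ 3)) ∧
    0 < (4 + (r : ℝ)) * (5 + r) * (2 + s) * (6 + r + 5 * s + r * s) *
          (54 + 27 * r + 3 * r ^ 2 + 99 * s + 90 * r * s + 18 * r ^ 2 * s + r ^ 3 * s
            + 69 * s ^ 2 + 102 * r * s ^ 2 + 27 * r ^ 2 * s ^ 2 + 2 * r ^ 3 * s ^ 2
            + 30 * s ^ 3 + 41 * r * s ^ 3 + 12 * r ^ 2 * s ^ 3 + r ^ 3 * s ^ 3) := by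
  have hr' : (0 : ℝ) ≤ r := by exact_mod_cast hr
  have hs' : (0 : ℝ) ≤ s := by exact_mod_cast hs
  refine ⟨?_, by positivity⟩
  unfold F
  rw [Q_two_add_four_add_one]
  unfold P
  push_cast
  generalize (r : ℝ) = r at *
  generalize (s : ℝ) = s at *
  have hB : (r + 5) * (s + 1) + 1 = 6 + r + 5 * s + r * s := by ring
  have hA : 2 * (r + 4) * (r + 4 + 1) * (s + 1 + 1) = 2 * ((4 + r) * (5 + r) * (2 + s)) := by ring
  rw [hB, hA]
  field_simp
  ring
end

section
/- For all integers m >= 0 and s >= 0, F(m+3, 3, s+1) - (6 + 8/(4*(s+1) + 1)) = (885 + 825*m + 210*m^2 + 2362*s + 2895*m*s + 847*m^2*s + 2007*s^2 + 3410*m*s^2 + 1119*m^2*s^2 + 642*s^3 + 1640*m*s^3 + 582*m^2*s^3 + 152*s^4 + 320*m*s^4 + 104*m^2*s^4) / ((3+m)*(2+s)*(5+4*s)*(30+15*m+66*s+53*m*s+52*s^2+56*m*s^2+20*s^3+20*m*s^3)), and in particular this difference is positive. -/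
/-- At `r = 3`, after shifting `m` and `s`, `Q` is twice a polynomial with positive coefficients. -/
lemma Q_add_three_three_add_one (m s : ℤ) :
    Q (m + 3) 3 (s + 1) =
      2 * (30 + 15 * m + 66 * s + 53 * m * s + 52 * s ^ 2 + 56 * m * s ^ 2
        + 20 * s ^ 3 + 20 * m * s ^ 3) := by
  unfold Q
  ring

theorem stmt18 (m s : ℤ) (hm : 0 ≤ m) (hs : 0 ≤ s) :
    F (m + 3) 3 (s + 1) - (6 + 8 / (4 * ((s : ℝ) + 1) + 1)) =
      (885 + 825 * (m : ℝ) + 210 * m ^ 2 + 2362 * s + 2895 * m * s + 847 * m ^ 2 * s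
          + 2007 * s ^ 2 + 3410 * m * s ^ 2 + 1119 * m ^ 2 * s ^ 2 + 642 * s ^ 3
          + 1640 * m * s ^ 3 + 582 * m ^ 2 * s ^ 3 + 152 * s ^ 4 + 320 * m * s ^ 4
          + 104 * m ^ 2 * s ^ 4) /
        ((3 + (m : ℝ)) * (2 + s) * (5 + 4 * s) *
          (30 + 15 * m + 66 * s + 53 * m * s + 52 * s ^ 2 + 56 * m * s ^ 2
            + 20 * s ^ 3 + 20 * m * s ^ 3)) ∧
    0 < F (m + 3) 3 (s + 1) - (6 + 8 / (4 * ((s : ℝ) + 1) + 1)) := by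
  have hm' : (0 : ℝ) ≤ m := by exact_mod_cast hm
  have hs' : (0 : ℝ) ≤ s := by exact_mod_cast hs
  rw [and_iff_left_of_imp (fun h => by rw [h]; positivity)]
  rw [F, Q_add_three_three_add_one, P]
  push_cast
  generalize (m : ℝ) = x at *
  generalize (s : ℝ) = y at *
  have hz : 4 * (y + 1) + 1 ≠ 0 := by positivity
  rw [sub_eq_iff_eq_add, ← sub_eq_zero]
  rw [add_div' _ _ _ hz, div_add_div _ _ (by positivity) hz, div_sub_div _ _ (by positivity)
    (by positivity), div_eq_zero_iff]
  left
  ring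
end
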